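/- arXiv:math/0003022 — 3 statements merged into one kernel-verified Lean document; each statement's English description precedes it below -/
import Mathlib

section
/- For all ξ, η ∈ ℝⁿ with min(|ξ|, |ξ − η|) ≤ |η|, one has |f(ξ) − f(η)| · |η|^{1−ν} ≤ 2^{1−ν} · |ξ − η|^{1−ν} · f₀(ξ − η)^ν · f(η); moreover the constant 2^{1−ν} can be replaced by 1 except in the region |ξ| ≤ |ξ − η| ≤ |η|. (Estimate (3.6) of Lemma 3.1.) -/
/-- The Gevrey weight `f₀(ξ) = exp(ρ |ξ|^ν)`. -/
noncomputable def f0gev {n : ℕ} (ν ρ : ℝ) (ξ : EuclideanSpace ℝ (Fin n)) : ℝ :=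
  Real.exp (ρ * ‖ξ‖ ^ ν)

/-- The Gevrey weight `f(ξ) = exp(ρ · max(|ξ|^ν, 1))`. -/
noncomputable def fgev {n : ℕ} (ν ρ : ℝ) (ξ : EuclideanSpace ℝ (Fin n)) : ℝ :=
  Real.exp (ρ * max (‖ξ‖ ^ ν) 1)

/-- Tangent-line bound for the concave function `x ↦ x ^ ν`, in homogeneous form. -/
lemma rpow_sub_rpow_le_mul_div_rpow {ν a b d : ℝ} (hν0 : 0 < ν) (hν1 : ν ≤ 1) (ha : 0 < a)
    (hb : 0 ≤ b) (hd : 0 ≤ d) (h : b ≤ a + d) :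
    b ^ ν - a ^ ν ≤ ν * d ^ ν * (d / a) ^ (1 - ν) := by
  have hs : 0 ≤ d / a := by positivity
  have hbern : (1 + d / a) ^ ν ≤ 1 + ν * (d / a) :=
    rpow_one_add_le_one_add_mul_self (by linarith) hν0.le hν1
  have hab : a * (1 + d / a) = a + d := by field_simp
  have hadd : a * (d / a) = d := by field_simp
  have hb' : b ^ ν ≤ a ^ ν * (1 + d / a) ^ ν := by
    rw [← Real.mul_rpow ha.le (by linarith), hab]
    exact Real.rpow_le_rpow hb h hν0.le
  have hsplit : d ^ ν * (d / a) ^ (1 - ν) = a ^ ν * (d / a) := by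
    rw [show d ^ ν = a ^ ν * (d / a) ^ ν by rw [← Real.mul_rpow ha.le hs, hadd], mul_assoc,
      ← Real.rpow_add_of_nonneg hs hν0.le (by linarith), add_sub_cancel, Real.rpow_one]
  have hmul := mul_le_mul_of_nonneg_left hbern (Real.rpow_nonneg ha.le ν)
  rw [mul_assoc, hsplit]
  linarith

lemma max_sub_max_le_sub_of_le {x y c : ℝ} (h : x ≤ y) : max y c - max x c ≤ y - x := by
  rcases le_total y c with hy | hy
  · rw [max_eq_right hy, max_eq_right (h.trans hy)]
    linarith
  · rw [max_eq_left hy]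
    linarith [le_max_left x c]

lemma exp_mul_sub_one_le {t Y : ℝ} (ht0 : 0 ≤ t) (ht1 : t ≤ 1) :
    Real.exp (t * Y) - 1 ≤ t * Real.exp Y := by
  have h := convexOn_exp.2 (Set.mem_univ Y) (Set.mem_univ 0) ht0 (sub_nonneg.2 ht1) (by ring)
  simp only [smul_eq_mul, mul_zero, add_zero, Real.exp_zero, mul_one] at h
  linarith

lemma two_mul_le_exp_of_nonneg {Y : ℝ} (hY : 0 ≤ Y) : 2 * Y ≤ Real.exp Y := by
  nlinarith [Real.quadratic_le_exp_of_nonneg hY, sq_nonneg (Y - 1)]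

/-- The weight difference for `d ≤ b ≤ a`: the constant is `1`. -/
lemma exp_max_sub_le_of_le {ν ρ a b d : ℝ} (hν0 : 0 < ν) (hν1 : ν ≤ 1) (hρ : 0 < ρ)
    (hd : 0 ≤ d) (hb : 0 < b) (hba : b ≤ a) (hadd : a ≤ b + d) (hdb : d ≤ b) :
    (Real.exp (ρ * max (a ^ ν) 1) - Real.exp (ρ * max (b ^ ν) 1)) * b ^ (1 - ν) ≤
      d ^ (1 - ν) * Real.exp (ρ * d ^ ν * ν) * Real.exp (ρ * max (b ^ ν) 1) := by
  have ht0 : 0 ≤ (d / b) ^ (1 - ν) := by positivity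
  have ht1 : (d / b) ^ (1 - ν) ≤ 1 :=
    Real.rpow_le_one (by positivity) ((div_le_one hb).2 hdb) (by linarith)
  have htb : (d / b) ^ (1 - ν) * b ^ (1 - ν) = d ^ (1 - ν) := by
    rw [← Real.mul_rpow (by positivity) hb.le, div_mul_cancel₀ _ hb.ne']
  have hdiff := (max_sub_max_le_sub_of_le (c := 1)
    (Real.rpow_le_rpow hb.le hba hν0.le)).trans
    (rpow_sub_rpow_le_mul_div_rpow hν0 hν1 hb (hb.le.trans hba) hd hadd)
  have hexp : Real.exp (ρ * max (a ^ ν) 1) ≤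
      Real.exp ((d / b) ^ (1 - ν) * (ρ * d ^ ν * ν)) * Real.exp (ρ * max (b ^ ν) 1) := by
    rw [← Real.exp_add]
    apply Real.exp_le_exp.2
    linarith [mul_le_mul_of_nonneg_left hdiff hρ.le]
  have hconv := exp_mul_sub_one_le (Y := ρ * d ^ ν * ν) ht0 ht1
  have hF := (Real.exp_pos (ρ * max (b ^ ν) 1)).le
  calc (Real.exp (ρ * max (a ^ ν) 1) - Real.exp (ρ * max (b ^ ν) 1)) * b ^ (1 - ν)
      ≤ ((d / b) ^ (1 - ν) * Real.exp (ρ * d ^ ν * ν) * Real.exp (ρ * max (b ^ ν) 1))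
          * b ^ (1 - ν) := by
        gcongr
        linarith [mul_le_mul_of_nonneg_right hconv hF]
    _ = _ := by rw [← htb]; ring

/-- The weight difference for `a ≤ b ≤ c * d`: only the size of the larger weight matters. -/
lemma exp_max_sub_le_of_le_mul {ν ρ a b c d : ℝ} (hν0 : 0 < ν) (hν1 : ν ≤ 1) (hρ : 0 < ρ)
    (hb : 0 ≤ b) (hc : 0 ≤ c) (hd : 0 ≤ d) (hbd : b ≤ c * d) :
    (Real.exp (ρ * max (b ^ ν) 1) - Real.exp (ρ * max (a ^ ν) 1)) * b ^ (1 - ν) ≤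
      c ^ (1 - ν) * d ^ (1 - ν) * Real.exp (ρ * d ^ ν * ν) * Real.exp (ρ * max (b ^ ν) 1) := by
  have h1 : b ^ (1 - ν) ≤ c ^ (1 - ν) * d ^ (1 - ν) := by
    rw [← Real.mul_rpow hc hd]
    exact Real.rpow_le_rpow hb hbd (by linarith)
  have h2 : 1 ≤ Real.exp (ρ * d ^ ν * ν) := Real.one_le_exp (by positivity)
  calc (Real.exp (ρ * max (b ^ ν) 1) - Real.exp (ρ * max (a ^ ν) 1)) * b ^ (1 - ν)
      ≤ Real.exp (ρ * max (b ^ ν) 1) * (c ^ (1 - ν) * d ^ (1 - ν)) := by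
        gcongr
        linarith [Real.exp_pos (ρ * max (a ^ ν) 1)]
    _ = c ^ (1 - ν) * d ^ (1 - ν) * 1 * Real.exp (ρ * max (b ^ ν) 1) := by ring
    _ ≤ _ := by gcongr

/-- The weight difference for `d ≤ a ≤ b`: the constant is `1`. -/
lemma exp_max_sub_le_of_le_of_le {ν ρ a b d : ℝ} (hν0 : 0 < ν) (hν1 : ν ≤ 1) (hρ : 0 < ρ)
    (hd : 0 ≤ d) (ha : 0 < a) (hab : a ≤ b) (hbad : b ≤ a + d) (hda : d ≤ a) :
    (Real.exp (ρ * max (b ^ ν) 1) - Real.exp (ρ * max (a ^ ν) 1)) * b ^ (1 - ν) ≤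
      d ^ (1 - ν) * Real.exp (ρ * d ^ ν * ν) * Real.exp (ρ * max (b ^ ν) 1) := by
  have hdiff := (max_sub_max_le_sub_of_le (c := 1)
    (Real.rpow_le_rpow ha.le hab hν0.le)).trans
    (rpow_sub_rpow_le_mul_div_rpow hν0 hν1 ha (ha.le.trans hab) hd hbad)
  have hY : 0 ≤ ρ * d ^ ν * ν := by positivity
  have hu0 : 0 ≤ (d / a) ^ (1 - ν) := by positivity
  have hua : (d / a) ^ (1 - ν) * a ^ (1 - ν) = d ^ (1 - ν) := by
    rw [← Real.mul_rpow (by positivity) ha.le, div_mul_cancel₀ _ ha.ne']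
  have hb2 : b ^ (1 - ν) ≤ 2 * a ^ (1 - ν) := by
    calc b ^ (1 - ν) ≤ (2 * a) ^ (1 - ν) :=
          Real.rpow_le_rpow (ha.le.trans hab) (by linarith) (by linarith)
      _ = 2 ^ (1 - ν) * a ^ (1 - ν) := Real.mul_rpow (by norm_num) ha.le
      _ ≤ 2 * a ^ (1 - ν) := by
          gcongr
          exact Real.rpow_le_self_of_one_le (by norm_num) (by linarith)
  have hF := (Real.exp_pos (ρ * max (b ^ ν) 1)).le
  have hsub : Real.exp (ρ * max (b ^ ν) 1) - Real.exp (ρ * max (a ^ ν) 1) ≤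
      (d / a) ^ (1 - ν) * (ρ * d ^ ν * ν) * Real.exp (ρ * max (b ^ ν) 1) := by
    have h1 := Real.add_one_le_exp (ρ * max (a ^ ν) 1 - ρ * max (b ^ ν) 1)
    have h2 : Real.exp (ρ * max (a ^ ν) 1) =
        Real.exp (ρ * max (a ^ ν) 1 - ρ * max (b ^ ν) 1) * Real.exp (ρ * max (b ^ ν) 1) := by
      rw [← Real.exp_add, sub_add_cancel]
    have h3 : 1 - Real.exp (ρ * max (a ^ ν) 1 - ρ * max (b ^ ν) 1) ≤
        (d / a) ^ (1 - ν) * (ρ * d ^ ν * ν) := by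
      linarith [mul_le_mul_of_nonneg_left hdiff hρ.le]
    linarith [mul_le_mul_of_nonneg_right h3 hF]
  calc (Real.exp (ρ * max (b ^ ν) 1) - Real.exp (ρ * max (a ^ ν) 1)) * b ^ (1 - ν)
      ≤ ((d / a) ^ (1 - ν) * (ρ * d ^ ν * ν) * Real.exp (ρ * max (b ^ ν) 1))
          * (2 * a ^ (1 - ν)) := by
        have hb : 0 ≤ b := ha.le.trans hab
        gcongr
    _ = d ^ (1 - ν) * (2 * (ρ * d ^ ν * ν)) * Real.exp (ρ * max (b ^ ν) 1) := by
        rw [← hua]; ring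
    _ ≤ _ := by
        gcongr
        exact two_mul_le_exp_of_nonneg hY

/-- Estimate (3.6) of Lemma 3.1: for all `ξ, η ∈ ℝⁿ` with `min(|ξ|, |ξ − η|) ≤ |η|`, one has
`|f(ξ) − f(η)| · |η|^{1−ν} ≤ 2^{1−ν} · |ξ − η|^{1−ν} · f₀(ξ − η)^ν · f(η)`; moreover the
constant `2^{1−ν}` can be replaced by `1` except in the region `|ξ| ≤ |ξ − η| ≤ |η|`. -/
theorem stmt3 (n : ℕ) (hn : 1 ≤ n) (ν ρ : ℝ) (hν0 : 0 < ν) (hν1 : ν ≤ 1) (hρ : 0 < ρ)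
    (ξ η : EuclideanSpace ℝ (Fin n)) (hreg : min ‖ξ‖ ‖ξ - η‖ ≤ ‖η‖) :
    |fgev ν ρ ξ - fgev ν ρ η| * ‖η‖ ^ (1 - ν) ≤
      (2 : ℝ) ^ (1 - ν) * ‖ξ - η‖ ^ (1 - ν) * f0gev ν ρ (ξ - η) ^ ν * fgev ν ρ η ∧
    (¬ (‖ξ‖ ≤ ‖ξ - η‖ ∧ ‖ξ - η‖ ≤ ‖η‖) →
      |fgev ν ρ ξ - fgev ν ρ η| * ‖η‖ ^ (1 - ν) ≤
        ‖ξ - η‖ ^ (1 - ν) * f0gev ν ρ (ξ - η) ^ ν * fgev ν ρ η) := by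
  have hf0 : f0gev ν ρ (ξ - η) ^ ν = Real.exp (ρ * ‖ξ - η‖ ^ ν * ν) :=
    (Real.exp_mul _ _).symm
  have hξ : ‖ξ‖ ≤ ‖η‖ + ‖ξ - η‖ := norm_le_norm_add_norm_sub' ξ η
  have hη : ‖η‖ ≤ ‖ξ‖ + ‖ξ - η‖ := norm_le_norm_add_norm_sub ξ η
  rw [hf0]
  unfold fgev
  have ha := norm_nonneg ξ
  have hb := norm_nonneg η
  have hd := norm_nonneg (ξ - η)
  generalize ‖ξ‖ = a at *
  generalize ‖η‖ = b at *
  generalize ‖ξ - η‖ = d at *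
  have hweaken : d ^ (1 - ν) * Real.exp (ρ * d ^ ν * ν) * Real.exp (ρ * max (b ^ ν) 1) ≤
      2 ^ (1 - ν) * d ^ (1 - ν) * Real.exp (ρ * d ^ ν * ν) * Real.exp (ρ * max (b ^ ν) 1) := by
    gcongr
    exact le_mul_of_one_le_left (by positivity)
      (Real.one_le_rpow (by norm_num) (by linarith))
  rcases lt_or_ge b a with hba | hab
  · have hdb : d ≤ b := (min_le_iff.1 hreg).resolve_left hba.not_ge
    have hb' : 0 < b := by linarith
    rw [abs_of_nonneg (sub_nonneg.2 (by gcongr))]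
    have key := exp_max_sub_le_of_le hν0 hν1 hρ hd hb' hba.le hξ hdb
    exact ⟨key.trans hweaken, fun _ => key⟩
  · rw [abs_sub_comm, abs_of_nonneg (sub_nonneg.2 (by gcongr))]
    by_cases hex : a ≤ d ∧ d ≤ b
    · exact ⟨exp_max_sub_le_of_le_mul hν0 hν1 hρ hb (by norm_num) hd (by linarith [hex.1]),
        fun h => absurd hex h⟩
    · suffices key : (Real.exp (ρ * max (b ^ ν) 1) - Real.exp (ρ * max (a ^ ν) 1)) * b ^ (1 - ν) ≤
          d ^ (1 - ν) * Real.exp (ρ * d ^ ν * ν) * Real.exp (ρ * max (b ^ ν) 1) from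
        ⟨key.trans hweaken, fun _ => key⟩
      rcases le_or_gt a d with had | hda
      · have hbd : b < d := not_le.1 fun h => hex ⟨had, h⟩
        simpa using exp_max_sub_le_of_le_mul (a := a) (c := 1) hν0 hν1 hρ hb zero_le_one hd
          (by linarith)
      · exact exp_max_sub_le_of_le_of_le hν0 hν1 hρ hd (hd.trans_lt hda) hab hη hda.le
end

section
/- For every integer m ≥ 0 and every t ≥ 1 one has ∫₁^t t₁^{−2} N₀(t₁) N_m(t₁) dt₁ = N_{m+1}(t) − h(t) N_m(t) ≤ N_{m+1}(t); moreover, if ∫₁^∞ h₀′(t₁) h(t₁)^{m+1} dt₁ < ∞, then ∫_t^∞ t₁^{−2} N₀(t₁) N_m(t₁) dt₁ = P_m(t). (Identities (3.76) and (3.77) of Lemma 3.8.) -/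
open MeasureTheory

/-- `h(t) = ∫₁^∞ max(t, t₁)⁻¹ h₀′(t₁) dt₁`. -/
noncomputable def hFun (h₀' : ℝ → ℝ) (t : ℝ) : ℝ :=
  ∫ t₁ in Set.Ici (1 : ℝ), (max t t₁)⁻¹ * h₀' t₁

/-- `N_m(t) = ∫₁^t h₀′(t₁) h(t₁)^m dt₁`. -/
noncomputable def NFun (h₀' : ℝ → ℝ) (m : ℕ) (t : ℝ) : ℝ :=
  ∫ t₁ in (1 : ℝ)..t, h₀' t₁ * hFun h₀' t₁ ^ m

/-- `P_m(t) = ∫₁^∞ h(max(t, t₁)) h₀′(t₁) h(t₁)^m dt₁`. -/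
noncomputable def PEstFun (h₀' : ℝ → ℝ) (m : ℕ) (t : ℝ) : ℝ :=
  ∫ t₁ in Set.Ici (1 : ℝ), hFun h₀' (max t t₁) * h₀' t₁ * hFun h₀' t₁ ^ m

theorem hasDerivWithinAt_integral_Ici {f : ℝ → ℝ} {a t : ℝ} (hf : ContinuousOn f (Set.Ici a))
    (ht : a ≤ t) :
    HasDerivWithinAt (fun x => ∫ s in a..x, f s) (f t) (Set.Ici a) t := by
  have hc : Continuous fun x => f (max a x) :=
    hf.comp_continuous (by fun_prop) fun x => le_max_left a x
  have hd := (hc.integral_hasStrictDerivAt a t).hasDerivAt.hasDerivWithinAt (s := Set.Ici a)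
  rw [max_eq_right ht] at hd
  have key : ∀ x ∈ Set.Ici a, (∫ s in a..x, f s) = ∫ s in a..x, f (max a s) := by
    intro x hx
    refine intervalIntegral.integral_congr fun s hs => ?_
    rw [Set.uIcc_of_le hx] at hs
    simp only [max_eq_right hs.1]
  exact hd.congr key (key t ht)

theorem intervalIntegrable_of_continuousOn_Ici {f : ℝ → ℝ} {a t : ℝ}
    (hf : ContinuousOn f (Set.Ici a)) (ht : a ≤ t) : IntervalIntegrable f volume a t := by
  refine ContinuousOn.intervalIntegrable (hf.mono ?_)
  rw [Set.uIcc_of_le ht]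
  exact Set.Icc_subset_Ici_self

theorem continuousOn_comp_max_mul {w g : ℝ → ℝ} {a t : ℝ} (hw : ContinuousOn w (Set.Ici a))
    (hg : ContinuousOn g (Set.Ici a)) (ht : a ≤ t) :
    ContinuousOn (fun s => w (max t s) * g s) (Set.Ici a) :=
  (hw.comp (by fun_prop) fun _ _ => ht.trans (le_max_left _ _)).mul hg

theorem norm_comp_max_mul_le {w g : ℝ → ℝ} {a t s : ℝ} (hanti : AntitoneOn w (Set.Ici a))
    (hw0 : ∀ x ∈ Set.Ici a, 0 ≤ w x) (hg0 : ∀ x ∈ Set.Ici a, 0 ≤ g x) (ht : a ≤ t)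
    (hs : s ∈ Set.Ici a) : ‖w (max t s) * g s‖ ≤ w s * g s := by
  have hm : max t s ∈ Set.Ici a := ht.trans (le_max_left _ _)
  rw [Real.norm_of_nonneg (mul_nonneg (hw0 _ hm) (hg0 s hs))]
  exact mul_le_mul_of_nonneg_right (hanti hs hm (le_max_right _ _)) (hg0 s hs)

theorem integral_comp_max_mul_eq {w g : ℝ → ℝ} {a t : ℝ} (hw : ContinuousOn w (Set.Ici a))
    (hg : ContinuousOn g (Set.Ici a)) (hint : IntegrableOn (fun s => w s * g s) (Set.Ici a))
    (ht : a ≤ t) :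
    ∫ s in Set.Ici a, w (max t s) * g s =
      w t * (∫ s in a..t, g s) + ((∫ s in Set.Ici a, w s * g s) - ∫ s in a..t, w s * g s) := by
  have hsub : Set.Ioi t ⊆ Set.Ici a := fun s hs => ht.trans (le_of_lt hs)
  have hdecomp : Set.Ici a = Set.Icc a t ∪ Set.Ioi t := (Set.Icc_union_Ioi_eq_Ici ht).symm
  have hdisj : Disjoint (Set.Icc a t) (Set.Ioi t) :=
    Set.disjoint_left.2 fun s hs hs' => not_lt_of_ge hs.2 hs'
  have hcm := continuousOn_comp_max_mul hw hg ht
  have htail : Set.EqOn (fun s => w (max t s) * g s) (fun s => w s * g s) (Set.Ioi t) :=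
    fun s hs => by simp only [max_eq_right (Set.mem_Ioi.1 hs).le]
  have hhead : Set.EqOn (fun s => w (max t s) * g s) (fun s => w t * g s) (Set.Icc a t) :=
    fun s hs => by simp only [max_eq_left hs.2]
  have e1 : ∫ s in Set.Ici a, w (max t s) * g s =
      (∫ s in Set.Icc a t, w (max t s) * g s) + ∫ s in Set.Ioi t, w (max t s) * g s := by
    rw [hdecomp]
    exact setIntegral_union hdisj measurableSet_Ioi
      (hcm.mono Set.Icc_subset_Ici_self).integrableOn_Icc
      ((hint.mono_set hsub).congr_fun htail.symm measurableSet_Ioi)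
  have e2 : ∫ s in Set.Ici a, w s * g s =
      (∫ s in Set.Icc a t, w s * g s) + ∫ s in Set.Ioi t, w s * g s := by
    conv_lhs => rw [hdecomp]
    exact setIntegral_union hdisj measurableSet_Ioi
      (hint.mono_set Set.Icc_subset_Ici_self) (hint.mono_set hsub)
  rw [e1, e2, setIntegral_congr_fun measurableSet_Icc hhead,
    setIntegral_congr_fun measurableSet_Ioi htail, integral_const_mul,
    intervalIntegral.integral_of_le ht, intervalIntegral.integral_of_le ht,
    integral_Icc_eq_integral_Ioc, integral_Icc_eq_integral_Ioc]
  ring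

theorem hasDerivWithinAt_integral_comp_max_mul {w w' g : ℝ → ℝ} {a t : ℝ}
    (hw : ∀ x ∈ Set.Ici a, HasDerivWithinAt w (w' x) (Set.Ici a) x)
    (hg : ContinuousOn g (Set.Ici a)) (hint : IntegrableOn (fun s => w s * g s) (Set.Ici a))
    (ht : a ≤ t) :
    HasDerivWithinAt (fun t => ∫ s in Set.Ici a, w (max t s) * g s)
      (w' t * ∫ s in a..t, g s) (Set.Ici a) t := by
  have hwc : ContinuousOn w (Set.Ici a) := fun x hx => (hw x hx).continuousWithinAt
  have hd := ((hw t ht).mul (hasDerivWithinAt_integral_Ici hg ht)).add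
    ((hasDerivWithinAt_integral_Ici (hwc.mul hg) ht).const_sub (∫ s in Set.Ici a, w s * g s))
  have hd' := hd.congr (fun x hx => integral_comp_max_mul_eq hwc hg hint hx)
    (integral_comp_max_mul_eq hwc hg hint ht)
  exact hd'.congr_deriv (by rw [Pi.mul_apply]; ring)

theorem tendsto_integral_comp_max_mul {w g : ℝ → ℝ} {a : ℝ} (hw : ContinuousOn w (Set.Ici a))
    (hanti : AntitoneOn w (Set.Ici a)) (hw0 : ∀ x ∈ Set.Ici a, 0 ≤ w x)
    (hlim : Filter.Tendsto w Filter.atTop (nhds 0))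
    (hg : ContinuousOn g (Set.Ici a)) (hg0 : ∀ x ∈ Set.Ici a, 0 ≤ g x)
    (hint : IntegrableOn (fun s => w s * g s) (Set.Ici a)) :
    Filter.Tendsto (fun t => ∫ s in Set.Ici a, w (max t s) * g s) Filter.atTop (nhds 0) := by
  have key := tendsto_integral_filter_of_dominated_convergence
    (μ := volume.restrict (Set.Ici a)) (l := Filter.atTop)
    (F := fun t s => w (max t s) * g s) (f := fun _ => 0) (fun s => w s * g s)
    ((Filter.eventually_ge_atTop a).mono fun t ht =>
      (continuousOn_comp_max_mul hw hg ht).aestronglyMeasurable measurableSet_Ici)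
    ((Filter.eventually_ge_atTop a).mono fun t ht =>
      (ae_restrict_mem measurableSet_Ici).mono fun s hs =>
        norm_comp_max_mul_le hanti hw0 hg0 ht hs)
    hint
    (Filter.Eventually.of_forall fun s => by
      have hmax : Filter.Tendsto (fun t : ℝ => max t s) Filter.atTop Filter.atTop :=
        Filter.tendsto_atTop_mono (fun t => le_max_left t s) Filter.tendsto_id
      simpa using (hlim.comp hmax).mul_const (g s))
  simpa using key

theorem antitoneOn_integral_comp_max_mul {w w' g : ℝ → ℝ} {a : ℝ}
    (hw : ∀ x ∈ Set.Ici a, HasDerivWithinAt w (w' x) (Set.Ici a) x)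
    (hw' : ∀ x ∈ Set.Ici a, w' x ≤ 0)
    (hg : ContinuousOn g (Set.Ici a)) (hg0 : ∀ x ∈ Set.Ici a, 0 ≤ g x)
    (hint : IntegrableOn (fun s => w s * g s) (Set.Ici a)) :
    AntitoneOn (fun t => ∫ s in Set.Ici a, w (max t s) * g s) (Set.Ici a) := by
  have hd := fun t (ht : t ∈ Set.Ici a) =>
    hasDerivWithinAt_integral_comp_max_mul (t := t) hw hg hint ht
  refine antitoneOn_of_hasDerivWithinAt_nonpos (convex_Ici a)
    (fun t ht => (hd t ht).continuousWithinAt)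
    (fun t ht => (hd t (interior_subset ht)).mono interior_subset) fun t ht => ?_
  have hat : a ≤ t := interior_subset ht
  exact mul_nonpos_of_nonpos_of_nonneg (hw' t hat)
    (intervalIntegral.integral_nonneg hat fun s hs => hg0 s hs.1)

theorem hasDerivWithinAt_inv_Ici {x : ℝ} (hx : x ∈ Set.Ici (1 : ℝ)) :
    HasDerivWithinAt (fun y : ℝ => y⁻¹) (-(x ^ 2)⁻¹) (Set.Ici 1) x :=
  (hasDerivAt_inv (zero_lt_one.trans_le hx).ne').hasDerivWithinAt

theorem hFun_nonneg {h₀' : ℝ → ℝ} (h₀'nonneg : ∀ t ∈ Set.Ici (1 : ℝ), 0 ≤ h₀' t) (t : ℝ) :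
    0 ≤ hFun h₀' t := by
  refine setIntegral_nonneg measurableSet_Ici fun s hs => mul_nonneg ?_ (h₀'nonneg s hs)
  exact inv_nonneg.2 (zero_le_one.trans (le_trans hs (le_max_right t s)))

theorem NFun_nonneg {h₀' : ℝ → ℝ} (h₀'nonneg : ∀ t ∈ Set.Ici (1 : ℝ), 0 ≤ h₀' t) (m : ℕ)
    {t : ℝ} (ht : 1 ≤ t) : 0 ≤ NFun h₀' m t :=
  intervalIntegral.integral_nonneg ht fun s hs =>
    mul_nonneg (h₀'nonneg s hs.1) (pow_nonneg (hFun_nonneg h₀'nonneg s) m)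

theorem hasDerivWithinAt_hFun {h₀' : ℝ → ℝ} (hcont : ContinuousOn h₀' (Set.Ici 1))
    (hint' : IntegrableOn (fun t => t⁻¹ * h₀' t) (Set.Ici 1)) {t : ℝ} (ht : t ∈ Set.Ici (1 : ℝ)) :
    HasDerivWithinAt (hFun h₀') (-(t ^ 2)⁻¹ * NFun h₀' 0 t) (Set.Ici 1) t := by
  have h := hasDerivWithinAt_integral_comp_max_mul (w := fun y => y⁻¹)
    (fun x hx => hasDerivWithinAt_inv_Ici hx) hcont hint' ht
  refine HasDerivWithinAt.congr_deriv (f := hFun h₀') h ?_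
  simp only [NFun, pow_zero, mul_one]

theorem continuousOn_hFun {h₀' : ℝ → ℝ} (hcont : ContinuousOn h₀' (Set.Ici 1))
    (hint' : IntegrableOn (fun t => t⁻¹ * h₀' t) (Set.Ici 1)) :
    ContinuousOn (hFun h₀') (Set.Ici 1) :=
  fun _ ht => (hasDerivWithinAt_hFun hcont hint' ht).continuousWithinAt

theorem antitoneOn_hFun {h₀' : ℝ → ℝ} (hcont : ContinuousOn h₀' (Set.Ici 1))
    (h₀'nonneg : ∀ t ∈ Set.Ici (1 : ℝ), 0 ≤ h₀' t)
    (hint' : IntegrableOn (fun t => t⁻¹ * h₀' t) (Set.Ici 1)) :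
    AntitoneOn (hFun h₀') (Set.Ici 1) :=
  antitoneOn_integral_comp_max_mul (w := fun y => y⁻¹) (fun _ hx => hasDerivWithinAt_inv_Ici hx)
    (fun _ _ => neg_nonpos.2 (inv_nonneg.2 (sq_nonneg _))) hcont h₀'nonneg hint'

theorem tendsto_hFun_atTop {h₀' : ℝ → ℝ} (hcont : ContinuousOn h₀' (Set.Ici 1))
    (h₀'nonneg : ∀ t ∈ Set.Ici (1 : ℝ), 0 ≤ h₀' t)
    (hint' : IntegrableOn (fun t => t⁻¹ * h₀' t) (Set.Ici 1)) :
    Filter.Tendsto (hFun h₀') Filter.atTop (nhds 0) :=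
  tendsto_integral_comp_max_mul (w := fun y => y⁻¹)
    (fun _ hx => (hasDerivWithinAt_inv_Ici hx).continuousWithinAt)
    (fun _ hx _ _ hxy => inv_anti₀ (zero_lt_one.trans_le hx) hxy)
    (fun _ hx => inv_nonneg.2 (zero_le_one.trans hx)) tendsto_inv_atTop_zero
    hcont h₀'nonneg hint'

theorem continuousOn_mul_hFun_pow {h₀' : ℝ → ℝ} (hcont : ContinuousOn h₀' (Set.Ici 1))
    (hint' : IntegrableOn (fun t => t⁻¹ * h₀' t) (Set.Ici 1)) (m : ℕ) :
    ContinuousOn (fun t => h₀' t * hFun h₀' t ^ m) (Set.Ici 1) :=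
  hcont.mul ((continuousOn_hFun hcont hint').pow m)

theorem hasDerivWithinAt_NFun {h₀' : ℝ → ℝ} (hcont : ContinuousOn h₀' (Set.Ici 1))
    (hint' : IntegrableOn (fun t => t⁻¹ * h₀' t) (Set.Ici 1)) (m : ℕ)
    {t : ℝ} (ht : t ∈ Set.Ici (1 : ℝ)) :
    HasDerivWithinAt (NFun h₀' m) (h₀' t * hFun h₀' t ^ m) (Set.Ici 1) t :=
  hasDerivWithinAt_integral_Ici (continuousOn_mul_hFun_pow hcont hint' m) ht

theorem continuousOn_NFun {h₀' : ℝ → ℝ} (hcont : ContinuousOn h₀' (Set.Ici 1))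
    (hint' : IntegrableOn (fun t => t⁻¹ * h₀' t) (Set.Ici 1)) (m : ℕ) :
    ContinuousOn (NFun h₀' m) (Set.Ici 1) :=
  fun _ ht => (hasDerivWithinAt_NFun hcont hint' m ht).continuousWithinAt

theorem integral_NFun_mul_NFun {h₀' : ℝ → ℝ} (hcont : ContinuousOn h₀' (Set.Ici 1))
    (hint' : IntegrableOn (fun t => t⁻¹ * h₀' t) (Set.Ici 1)) (m : ℕ) {t : ℝ} (ht : 1 ≤ t) :
    (∫ t₁ in (1 : ℝ)..t, (t₁ ^ 2)⁻¹ * (NFun h₀' 0 t₁ * NFun h₀' m t₁)) =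
      NFun h₀' (m + 1) t - hFun h₀' t * NFun h₀' m t := by
  have hd : ∀ x ∈ Set.Ici (1 : ℝ),
      HasDerivWithinAt (fun x => NFun h₀' (m + 1) x - hFun h₀' x * NFun h₀' m x)
        ((x ^ 2)⁻¹ * (NFun h₀' 0 x * NFun h₀' m x)) (Set.Ici 1) x := by
    intro x hx
    refine ((hasDerivWithinAt_NFun hcont hint' (m + 1) hx).sub
      ((hasDerivWithinAt_hFun hcont hint' hx).mul
        (hasDerivWithinAt_NFun hcont hint' m hx))).congr_deriv ?_
    ring
  have hc : ContinuousOn (fun x : ℝ => (x ^ 2)⁻¹ * (NFun h₀' 0 x * NFun h₀' m x))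
      (Set.Ici 1) :=
    ((continuousOn_pow 2).inv₀ fun x hx => pow_ne_zero 2 (zero_lt_one.trans_le hx).ne').mul
      ((continuousOn_NFun hcont hint' 0).mul (continuousOn_NFun hcont hint' m))
  rw [intervalIntegral.integral_eq_sub_of_hasDerivAt_of_le ht
    (fun x hx => ((hd x hx.1).continuousWithinAt).mono Set.Icc_subset_Ici_self)
    (fun x hx => (hd x hx.1.le).hasDerivAt (Ici_mem_nhds hx.1))
    (intervalIntegrable_of_continuousOn_Ici hc ht)]
  simp [NFun]

theorem integral_Ici_NFun_mul_NFun {h₀' : ℝ → ℝ} (hcont : ContinuousOn h₀' (Set.Ici 1))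
    (h₀'nonneg : ∀ t ∈ Set.Ici (1 : ℝ), 0 ≤ h₀' t)
    (hint' : IntegrableOn (fun t => t⁻¹ * h₀' t) (Set.Ici 1)) (m : ℕ)
    (hint : IntegrableOn (fun t₁ => h₀' t₁ * hFun h₀' t₁ ^ (m + 1)) (Set.Ici 1))
    {t : ℝ} (ht : 1 ≤ t) :
    ∫ t₁ in Set.Ici t, (t₁ ^ 2)⁻¹ * (NFun h₀' 0 t₁ * NFun h₀' m t₁) = PEstFun h₀' m t := by
  have hg := continuousOn_mul_hFun_pow hcont hint' m
  have hintg : IntegrableOn (fun s => hFun h₀' s * (h₀' s * hFun h₀' s ^ m)) (Set.Ici 1) :=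
    hint.congr_fun (fun s _ => by ring) measurableSet_Ici
  have hP : PEstFun h₀' m =
      fun t => ∫ s in Set.Ici (1 : ℝ), hFun h₀' (max t s) * (h₀' s * hFun h₀' s ^ m) := by
    funext x
    simp only [PEstFun, mul_assoc]
  have hd : ∀ x ∈ Set.Ici (1 : ℝ), HasDerivWithinAt (fun x => -PEstFun h₀' m x)
      ((x ^ 2)⁻¹ * (NFun h₀' 0 x * NFun h₀' m x)) (Set.Ici 1) x := by
    intro x hx
    rw [hP]
    refine (hasDerivWithinAt_integral_comp_max_mul
      (fun y hy => hasDerivWithinAt_hFun hcont hint' hy) hg hintg hx).neg.congr_deriv ?_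
    rw [NFun.eq_1 h₀' m]
    ring
  have hlim : Filter.Tendsto (fun x => -PEstFun h₀' m x) Filter.atTop (nhds 0) := by
    rw [hP]
    simpa using (tendsto_integral_comp_max_mul (continuousOn_hFun hcont hint')
      (antitoneOn_hFun hcont h₀'nonneg hint') (fun x _ => hFun_nonneg h₀'nonneg x)
      (tendsto_hFun_atTop hcont h₀'nonneg hint') hg
      (fun x hx => mul_nonneg (h₀'nonneg x hx) (pow_nonneg (hFun_nonneg h₀'nonneg x) m))
      hintg).neg
  rw [integral_Ici_eq_integral_Ioi, integral_Ioi_of_hasDerivAt_of_nonneg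
    ((hd t ht).continuousWithinAt.mono (Set.Ici_subset_Ici.2 ht))
    (fun x hx => (hd x (ht.trans (le_of_lt hx))).hasDerivAt (Ici_mem_nhds (ht.trans_lt hx)))
    (fun x hx => mul_nonneg (inv_nonneg.2 (sq_nonneg x))
      (mul_nonneg (NFun_nonneg h₀'nonneg 0 (ht.trans (le_of_lt hx)))
        (NFun_nonneg h₀'nonneg m (ht.trans (le_of_lt hx))))) hlim]
  ring

/-- Identities (3.76) and (3.77) of Lemma 3.8: for `m ≥ 0` and `t ≥ 1`,
`∫₁^t t₁⁻² N₀(t₁) N_m(t₁) dt₁ = N_{m+1}(t) − h(t) N_m(t) ≤ N_{m+1}(t)`, and if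
`∫₁^∞ h₀′ h^{m+1} < ∞` then `∫_t^∞ t₁⁻² N₀(t₁) N_m(t₁) dt₁ = P_m(t)`. -/
theorem stmt12 (h₀ h₀' : ℝ → ℝ)
    (hderiv : ∀ t ∈ Set.Ici (1 : ℝ), HasDerivWithinAt h₀ (h₀' t) (Set.Ici 1) t)
    (hcont : ContinuousOn h₀' (Set.Ici 1))
    (h₀nonneg : ∀ t ∈ Set.Ici (1 : ℝ), 0 ≤ h₀ t)
    (h₀'nonneg : ∀ t ∈ Set.Ici (1 : ℝ), 0 ≤ h₀' t)
    (hint₀ : IntegrableOn (fun t => (t ^ 2)⁻¹ * h₀ t) (Set.Ici 1))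
    (hint' : IntegrableOn (fun t => t⁻¹ * h₀' t) (Set.Ici 1))
    (m : ℕ) (t : ℝ) (ht : 1 ≤ t) :
    (∫ t₁ in (1 : ℝ)..t, (t₁ ^ 2)⁻¹ * (NFun h₀' 0 t₁ * NFun h₀' m t₁)) =
        NFun h₀' (m + 1) t - hFun h₀' t * NFun h₀' m t ∧
    NFun h₀' (m + 1) t - hFun h₀' t * NFun h₀' m t ≤ NFun h₀' (m + 1) t ∧
    (IntegrableOn (fun t₁ => h₀' t₁ * hFun h₀' t₁ ^ (m + 1)) (Set.Ici 1) →
      ∫ t₁ in Set.Ici t, (t₁ ^ 2)⁻¹ * (NFun h₀' 0 t₁ * NFun h₀' m t₁) = PEstFun h₀' m t) := by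
  exact ⟨integral_NFun_mul_NFun hcont hint' m ht,
    sub_le_self _ (mul_nonneg (hFun_nonneg h₀'nonneg t) (NFun_nonneg h₀'nonneg m ht)),
    fun hint => integral_Ici_NFun_mul_NFun hcont h₀'nonneg hint' m hint ht⟩
end

section
/- Let 0 < ν ≤ 1 and n ≥ 1. Then for all ξ, η ∈ ℝⁿ one has f̃(|ξ|) ≤ f̃(|ξ − η|) · f̃(|η|), and |f̃(|ξ|) − f̃(|η|)| · |η|^{1−ν} ≤ |ξ − η|^{1−ν} · f̃(|ξ − η|) · f̃(|η|). (Estimates (A.9) and (A.12) of Lemma A.2.) -/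
/-- The Gevrey generating function `f̃(x) = Σ_{j≥0} (j!)^{−1/ν} x^j`. -/
noncomputable def ftilde (ν x : ℝ) : ℝ :=
  ∑' j : ℕ, (j.factorial : ℝ) ^ (-(1 / ν)) * x ^ j

/-- The coefficient `(j!)^{-1/ν}` is at most `(j!)⁻¹`. -/
theorem factorial_rpow_le_inv {ν : ℝ} (hν0 : 0 < ν) (hν1 : ν ≤ 1) (j : ℕ) :
    (j.factorial : ℝ) ^ (-(1 / ν)) ≤ (j.factorial : ℝ)⁻¹ := by
  have h1 : (1 : ℝ) ≤ j.factorial := by exact_mod_cast j.factorial_pos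
  have h2 : 1 ≤ 1 / ν := by rwa [le_div_iff₀ hν0, one_mul]
  rw [← Real.rpow_neg_one]
  exact Real.rpow_le_rpow_of_exponent_le h1 (by linarith)

theorem summable_ftilde {ν : ℝ} (hν0 : 0 < ν) (hν1 : ν ≤ 1) {x : ℝ} (hx : 0 ≤ x) :
    Summable fun j : ℕ => (j.factorial : ℝ) ^ (-(1 / ν)) * x ^ j := by
  refine Summable.of_nonneg_of_le (fun j => by positivity) (fun j => ?_)
    (Real.summable_pow_div_factorial x)
  rw [div_eq_inv_mul _ (j.factorial : ℝ)]
  exact mul_le_mul_of_nonneg_right (factorial_rpow_le_inv hν0 hν1 j) (by positivity)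

theorem ftilde_mono {ν : ℝ} (hν0 : 0 < ν) (hν1 : ν ≤ 1) {x y : ℝ} (hx : 0 ≤ x) (hxy : x ≤ y) :
    ftilde ν x ≤ ftilde ν y :=
  (summable_ftilde hν0 hν1 hx).tsum_le_tsum (fun j => by gcongr)
    (summable_ftilde hν0 hν1 (hx.trans hxy))

theorem ftilde_eq_one_add {ν : ℝ} (hν0 : 0 < ν) (hν1 : ν ≤ 1) {x : ℝ} (hx : 0 ≤ x) :
    ftilde ν x = 1 + ∑' j : ℕ, ((j + 1).factorial : ℝ) ^ (-(1 / ν)) * x ^ (j + 1) := by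
  rw [ftilde, (summable_ftilde hν0 hν1 hx).tsum_eq_zero_add]
  simp

theorem ftilde_nonneg {ν x : ℝ} (hx : 0 ≤ x) : 0 ≤ ftilde ν x :=
  tsum_nonneg fun _ => by positivity

theorem factorial_add_rpow (s : ℝ) (k l : ℕ) :
    ((k + l).factorial : ℝ) ^ (-s) =
      (k.factorial : ℝ) ^ (-s) * (l.factorial : ℝ) ^ (-s) * ((k + l).choose k : ℝ) ^ (-s) := by
  rw [← Real.mul_rpow (by positivity) (by positivity),
    ← Real.mul_rpow (by positivity) (by positivity)]
  congr 1
  have h := Nat.add_choose_mul_factorial_mul_factorial k l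
  rw [Nat.choose_symm_add] at *
  rw [← h]
  push_cast
  ring

theorem factorial_add_rpow_mul_choose (s : ℝ) (k l : ℕ) :
    ((k + l).factorial : ℝ) ^ (-s) * ((k + l).choose k : ℝ) =
      (k.factorial : ℝ) ^ (-s) * (l.factorial : ℝ) ^ (-s) *
        ((k + l).choose k : ℝ) ^ (-(s - 1)) := by
  have hC : (0 : ℝ) < (k + l).choose k := by
    exact_mod_cast Nat.choose_pos (Nat.le_add_right k l)
  rw [factorial_add_rpow, mul_assoc _ _ ((k + l).choose k : ℝ), ← Real.rpow_add_one hC.ne']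
  congr 2
  ring

theorem succ_le_add_choose {k : ℕ} (hk : k ≠ 0) (l : ℕ) : l + 1 ≤ (k + l).choose k := by
  rw [Nat.choose_symm_add]
  calc l + 1 = (l + 1).choose l := by simp
    _ ≤ (k + l).choose l := Nat.choose_le_choose l (by omega)

theorem ftilde_add_le_mul {ν : ℝ} (hν0 : 0 < ν) (hν1 : ν ≤ 1) {x y : ℝ} (hx : 0 ≤ x)
    (hy : 0 ≤ y) : ftilde ν (x + y) ≤ ftilde ν x * ftilde ν y := by
  have hsx := summable_ftilde hν0 hν1 hx
  have hsy := summable_ftilde hν0 hν1 hy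
  have hs : 1 ≤ 1 / ν := by rwa [le_div_iff₀ hν0, one_mul]
  rw [ftilde, ftilde, ftilde, tsum_mul_tsum_eq_tsum_sum_antidiagonal_of_summable_norm
    hsx.norm hsy.norm]
  refine (summable_ftilde hν0 hν1 (add_nonneg hx hy)).tsum_le_tsum (fun j => ?_)
    (summable_norm_sum_mul_antidiagonal_of_summable_norm hsx.norm hsy.norm).of_norm
  rw [(Commute.all x y).add_pow', Finset.mul_sum]
  refine Finset.sum_le_sum fun p hp => ?_
  obtain rfl := Finset.HasAntidiagonal.mem_antidiagonal.mp hp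
  have hC : (1 : ℝ) ≤ (p.1 + p.2).choose p.1 := by
    exact_mod_cast Nat.choose_pos (Nat.le_add_right p.1 p.2)
  rw [nsmul_eq_mul, ← mul_assoc, factorial_add_rpow_mul_choose,
    mul_comm (_ * _) (_ ^ (-(1 / ν - 1))), mul_assoc, mul_mul_mul_comm]
  exact mul_le_of_le_one_left (by positivity)
    (Real.rpow_le_one_of_one_le_of_nonpos hC (by linarith))

/-- Increments of `f̃` over a fixed step are nondecreasing. -/
theorem ftilde_add_sub_le {ν : ℝ} (hν0 : 0 < ν) (hν1 : ν ≤ 1) {x y t : ℝ} (hx : 0 ≤ x)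
    (hxy : x ≤ y) (ht : 0 ≤ t) :
    ftilde ν (x + t) - ftilde ν x ≤ ftilde ν (y + t) - ftilde ν y := by
  have hy := hx.trans hxy
  have h1 := summable_ftilde hν0 hν1 hx
  have h2 := summable_ftilde hν0 hν1 hy
  have h3 := summable_ftilde hν0 hν1 (add_nonneg hx ht)
  have h4 := summable_ftilde hν0 hν1 (add_nonneg hy ht)
  rw [ftilde, ftilde, ftilde, ftilde, ← h3.tsum_sub h1, ← h4.tsum_sub h2]
  refine (h3.sub h1).tsum_le_tsum (fun j => ?_) (h4.sub h2)
  rw [← mul_sub, ← mul_sub]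
  refine mul_le_mul_of_nonneg_left ?_ (by positivity)
  induction j with
  | zero => simp
  | succ j ih =>
    have h5 : x ^ j ≤ y ^ j := by gcongr
    have h6 : 0 ≤ (x + t) ^ j - x ^ j := sub_nonneg.mpr (by gcongr; linarith)
    calc (x + t) ^ (j + 1) - x ^ (j + 1)
        = (x + t) * ((x + t) ^ j - x ^ j) + t * x ^ j := by ring
      _ ≤ (y + t) * ((y + t) ^ j - y ^ j) + t * y ^ j := by gcongr
      _ = (y + t) ^ (j + 1) - y ^ (j + 1) := by ring

theorem ftilde_sub_one_le {ν : ℝ} (hν0 : 0 < ν) (hν1 : ν ≤ 1) {t : ℝ} (ht : 0 ≤ t) :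
    ftilde ν t - 1 ≤ t ^ (1 - ν) * ftilde ν t := by
  have hf := ftilde_nonneg (ν := ν) ht
  rcases le_total 1 t with h1 | h1
  · have := Real.one_le_rpow h1 (sub_nonneg.mpr hν1)
    nlinarith
  · have hs := summable_ftilde hν0 hν1 ht
    have h2 : ftilde ν t - 1 ≤ t * ftilde ν t := by
      rw [ftilde_eq_one_add hν0 hν1 ht, add_sub_cancel_left, ← ftilde_eq_one_add hν0 hν1 ht,
        ftilde, ← tsum_mul_left]
      refine ((summable_nat_add_iff 1).mpr hs).tsum_le_tsum (fun j => ?_) (hs.mul_left t)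
      rw [pow_succ', mul_left_comm]
      refine mul_le_mul_of_nonneg_left (mul_le_mul_of_nonneg_right ?_ (by positivity)) ht
      refine Real.rpow_le_rpow_of_nonpos (by positivity) ?_ ?_
      · exact_mod_cast Nat.factorial_le (Nat.le_succ j)
      · have : 0 < 1 / ν := by positivity
        linarith
    refine h2.trans (mul_le_mul_of_nonneg_right ?_ hf)
    rcases ht.eq_or_lt with rfl | h0
    · exact Real.rpow_nonneg le_rfl _
    · simpa using Real.rpow_le_rpow_of_exponent_ge h0 h1 (show 1 - ν ≤ 1 by linarith)

/-- Young's inequality for two consecutive terms of the series of `f̃`. -/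
theorem ftilde_term_interpolation {ν : ℝ} (hν0 : 0 < ν) (hν1 : ν ≤ 1) {y : ℝ} (hy : 0 ≤ y)
    (l : ℕ) :
    (l.factorial : ℝ) ^ (-(1 / ν)) * y ^ l * (((l + 1 : ℕ) : ℝ) ^ (-(1 / ν - 1)) * y ^ (1 - ν)) ≤
      ν * ((l.factorial : ℝ) ^ (-(1 / ν)) * y ^ l) +
        (1 - ν) * (((l + 1).factorial : ℝ) ^ (-(1 / ν)) * y ^ (l + 1)) := by
  have h1 : ((l + 1 : ℕ) : ℝ) ^ (-(1 / ν - 1)) * y ^ (1 - ν) =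
      (((l + 1 : ℕ) : ℝ) ^ (-(1 / ν)) * y) ^ (1 - ν) := by
    rw [Real.mul_rpow (by positivity) hy, ← Real.rpow_mul (by positivity)]
    congr 2
    field_simp
  have h2 := Real.geom_mean_le_arith_mean2_weighted hν0.le (sub_nonneg.mpr hν1) zero_le_one
    (show 0 ≤ ((l + 1 : ℕ) : ℝ) ^ (-(1 / ν)) * y by positivity) (by ring)
  rw [Real.one_rpow, one_mul, mul_one] at h2
  rw [h1]
  refine (mul_le_mul_of_nonneg_left h2 (by positivity)).trans_eq ?_
  rw [Nat.factorial_succ, Nat.cast_mul, Real.mul_rpow (by positivity) (by positivity)]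
  ring

theorem ftilde_add_sub_mul_rpow_le {ν : ℝ} (hν0 : 0 < ν) (hν1 : ν ≤ 1) {t y : ℝ} (ht : 0 ≤ t)
    (hy : 0 ≤ y) :
    (ftilde ν (y + t) - ftilde ν y) * y ^ (1 - ν) ≤ (ftilde ν t - 1) * ftilde ν y := by
  have hs : 1 ≤ 1 / ν := by rwa [le_div_iff₀ hν0, one_mul]
  have hst := summable_ftilde hν0 hν1 ht
  have hsy := summable_ftilde hν0 hν1 hy
  have hsy' := (summable_nat_add_iff 1).mpr hsy
  have hsty := summable_ftilde hν0 hν1 (add_nonneg ht hy)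
  set u : ℕ → ℝ := fun k => if k = 0 then 0 else (k.factorial : ℝ) ^ (-(1 / ν)) * t ^ k with hu
  set v : ℕ → ℝ := fun l => (l.factorial : ℝ) ^ (-(1 / ν)) * y ^ l *
    (((l + 1 : ℕ) : ℝ) ^ (-(1 / ν - 1)) * y ^ (1 - ν)) with hv
  have hu0 : ∀ k, 0 ≤ u k := fun k => by
    simp only [hu]; split_ifs <;> positivity
  have hv0 : ∀ l, 0 ≤ v l := fun l => by positivity
  have hus : Summable u := hst.of_nonneg_of_le hu0 fun k => by
    simp only [hu]; split_ifs
    · positivity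
    · rfl
  have hvb := (hsy.mul_left ν).add (hsy'.mul_left (1 - ν))
  have hvs : Summable v := hvb.of_nonneg_of_le hv0 (ftilde_term_interpolation hν0 hν1 hy)
  have hut : ∑' k, u k = ftilde ν t - 1 := by
    rw [hus.tsum_eq_zero_add, ftilde_eq_one_add hν0 hν1 ht]
    simp [hu]
  have hvt : ∑' l, v l ≤ ftilde ν y := by
    refine (hvs.tsum_le_tsum (ftilde_term_interpolation hν0 hν1 hy) hvb).trans ?_
    rw [(hsy.mul_left ν).tsum_add (hsy'.mul_left (1 - ν)), tsum_mul_left, tsum_mul_left]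
    have h := ftilde_eq_one_add hν0 hν1 hy
    rw [← ftilde]
    nlinarith
  have hut0 : 0 ≤ ftilde ν t - 1 := hut ▸ tsum_nonneg hu0
  refine le_trans ?_ (mul_le_mul_of_nonneg_left hvt hut0)
  rw [← hut, tsum_mul_tsum_eq_tsum_sum_antidiagonal_of_summable_norm hus.norm hvs.norm,
    add_comm y t, ftilde, ftilde, ← hsty.tsum_sub hsy, ← tsum_mul_right]
  refine ((hsty.sub hsy).mul_right _).tsum_le_tsum (fun j => ?_)
    (summable_norm_sum_mul_antidiagonal_of_summable_norm hus.norm hvs.norm).of_norm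
  have hyj : y ^ j = ∑ p ∈ Finset.HasAntidiagonal.antidiagonal j, if p.1 = 0 then y ^ p.2 else 0 := by
    rw [Finset.sum_eq_single (0, j)]
    · simp
    · rintro ⟨a, b⟩ hab hne
      have hab := Finset.HasAntidiagonal.mem_antidiagonal.mp hab
      refine if_neg fun h => hne ?_
      simp_all
    · simp
  rw [← mul_sub, (Commute.all t y).add_pow', hyj, ← Finset.sum_sub_distrib, Finset.mul_sum,
    Finset.sum_mul]
  refine Finset.sum_le_sum fun p hp => ?_
  obtain ⟨k, l⟩ := p
  obtain rfl := Finset.HasAntidiagonal.mem_antidiagonal.mp hp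
  by_cases hk : k = 0
  · simp [hk, hu]
  · have hC : ((l + 1 : ℕ) : ℝ) ≤ (k + l).choose k := by exact_mod_cast succ_le_add_choose hk l
    have hCs : ((k + l).choose k : ℝ) ^ (-(1 / ν - 1)) ≤ ((l + 1 : ℕ) : ℝ) ^ (-(1 / ν - 1)) :=
      Real.rpow_le_rpow_of_nonpos (by positivity) hC (by linarith)
    simp only [hu, hv, if_neg hk, sub_zero, nsmul_eq_mul]
    rw [← mul_assoc, factorial_add_rpow_mul_choose]
    calc _ = (k.factorial : ℝ) ^ (-(1 / ν)) * (l.factorial : ℝ) ^ (-(1 / ν)) *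
          (t ^ k * y ^ l) * y ^ (1 - ν) * ((k + l).choose k : ℝ) ^ (-(1 / ν - 1)) := by ring
      _ ≤ (k.factorial : ℝ) ^ (-(1 / ν)) * (l.factorial : ℝ) ^ (-(1 / ν)) *
          (t ^ k * y ^ l) * y ^ (1 - ν) * ((l + 1 : ℕ) : ℝ) ^ (-(1 / ν - 1)) :=
        mul_le_mul_of_nonneg_left hCs (by positivity)
      _ = _ := by ring

/-- Estimates (A.9) and (A.12) of Lemma A.2: for `0 < ν ≤ 1`, `n ≥ 1` and all `ξ, η ∈ ℝⁿ`,
`f̃(|ξ|) ≤ f̃(|ξ − η|) f̃(|η|)` and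
`|f̃(|ξ|) − f̃(|η|)| · |η|^{1−ν} ≤ |ξ − η|^{1−ν} f̃(|ξ − η|) f̃(|η|)`. -/
theorem stmt18 (n : ℕ) (hn : 1 ≤ n) (ν : ℝ) (hν0 : 0 < ν) (hν1 : ν ≤ 1)
    (ξ η : EuclideanSpace ℝ (Fin n)) :
    ftilde ν ‖ξ‖ ≤ ftilde ν ‖ξ - η‖ * ftilde ν ‖η‖ ∧
    |ftilde ν ‖ξ‖ - ftilde ν ‖η‖| * ‖η‖ ^ (1 - ν) ≤
      ‖ξ - η‖ ^ (1 - ν) * ftilde ν ‖ξ - η‖ * ftilde ν ‖η‖ := by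
  have hx := norm_nonneg ξ
  have hy := norm_nonneg η
  have ht := norm_nonneg (ξ - η)
  have hxle : ‖ξ‖ ≤ ‖η‖ + ‖ξ - η‖ := by
    linarith [norm_sub_norm_le ξ η]
  have hyle : ‖η‖ ≤ ‖ξ‖ + ‖ξ - η‖ := by
    linarith [norm_sub_norm_le η ξ, norm_sub_rev ξ η]
  constructor
  · exact (ftilde_mono hν0 hν1 hx (hxle.trans_eq (add_comm _ _))).trans
      (ftilde_add_le_mul hν0 hν1 ht hy)
  · have habs : |ftilde ν ‖ξ‖ - ftilde ν ‖η‖| ≤ ftilde ν (‖η‖ + ‖ξ - η‖) - ftilde ν ‖η‖ := by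
      have h1 := ftilde_mono hν0 hν1 hx hxle
      have h2 := ftilde_mono hν0 hν1 hy hyle
      rcases le_total ‖ξ‖ ‖η‖ with h | h
      · have h3 := ftilde_add_sub_le hν0 hν1 hx h ht
        have h4 := ftilde_mono hν0 hν1 hx h
        rw [abs_le]
        constructor <;> linarith
      · rw [abs_of_nonneg (sub_nonneg.mpr (ftilde_mono hν0 hν1 hy h))]
        linarith
    calc _ ≤ (ftilde ν (‖η‖ + ‖ξ - η‖) - ftilde ν ‖η‖) * ‖η‖ ^ (1 - ν) :=
          mul_le_mul_of_nonneg_right habs (by positivity)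
      _ ≤ (ftilde ν ‖ξ - η‖ - 1) * ftilde ν ‖η‖ := ftilde_add_sub_mul_rpow_le hν0 hν1 ht hy
      _ ≤ _ := mul_le_mul_of_nonneg_right (ftilde_sub_one_le hν0 hν1 ht) (ftilde_nonneg hy)
end
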